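/- arXiv:1111.1936 — 8 statements merged into one kernel-verified Lean document; each statement's English description precedes it below -/
import Mathlib

section
/- Let n, k ≥ 2 be natural numbers with k = C(n, ⌊n/2⌋) (the binomial coefficient). Let L be a co-Heyting algebra such that ⊤ is the join of an antichain of m join-irreducible elements with m ≤ n, i.e., there are pairwise incomparable join-irreducible elements b_1, …, b_m ∈ L with b_1 ⊔ … ⊔ b_m = ⊤. Then for every tuple a_1, …, a_k of elements of L, the value of the formula φ_k is ⊥, i.e.: (⨅_{i ≠ j, 1 ≤ i,j ≤ k} (￢a_j \ ￢a_i)) ⊓ ￢(⨆_{1 ≤ i ≤ k} ￢a_i) = ⊥, where the infimum is over all ordered pairs (i,j) with i ≠ j. (This is Theorem 3.10(i): every Brouwer algebra in the class 𝔅_m with m ≤ n satisfies the generalized weak law of the excluded middle φ_k.) -/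
theorem Nat.choose_half_lt_choose_half_succ {n : ℕ} (hn : 1 ≤ n) :
    n.choose (n / 2) < (n + 1).choose ((n + 1) / 2) := by
  obtain ⟨r, hr⟩ : ∃ r, (n + 1) / 2 = r + 1 := ⟨(n + 1) / 2 - 1, by omega⟩
  rw [hr, Nat.choose_succ_succ']
  have h₁ : 0 < n.choose r := Nat.choose_pos (by omega)
  have h₂ : 0 < n.choose (r + 1) := Nat.choose_pos (by omega)
  rcases (by omega : n / 2 = r ∨ n / 2 = r + 1) with h | h <;> rw [h] <;> omega

theorem Nat.choose_half_monotone : Monotone fun n : ℕ => n.choose (n / 2) := by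
  refine monotone_nat_of_le_succ fun n => ?_
  rcases Nat.eq_zero_or_pos n with rfl | hn
  · simp
  · exact (Nat.choose_half_lt_choose_half_succ hn).le

/-- An indexed form of Sperner's theorem for sets that all avoid a common point. -/
theorem Finset.card_le_choose_half_of_notMem {ι α : Type*} [Fintype ι] [Fintype α]
    [DecidableEq α] (S : ι → Finset α) (hS : ∀ i j, i ≠ j → ¬ S i ⊆ S j)
    (x : α) (hx : ∀ i, x ∉ S i) :
    Fintype.card ι ≤ (Fintype.card α - 1).choose ((Fintype.card α - 1) / 2) := by
  classical
  let T : ι → Finset {y // y ≠ x} := fun i => (S i).subtype _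
  have hT : ∀ i j, T i ⊆ T j → i = j := by
    intro i j hij
    by_contra hne
    refine hS i j hne fun y hy => ?_
    have hyx : y ≠ x := fun h => hx i (h ▸ hy)
    have hyT : (⟨y, hyx⟩ : {y // y ≠ x}) ∈ T i := Finset.mem_subtype.2 hy
    exact Finset.mem_subtype.1 (hij hyT)
  have hinj : Function.Injective T := fun i j h => hT i j h.le
  have hanti : IsAntichain (· ⊆ ·) (SetLike.coe (Finset.univ.image T)) := by
    intro A hA B hB hne hAB
    obtain ⟨i, -, rfl⟩ := Finset.mem_image.1 hA
    obtain ⟨j, -, rfl⟩ := Finset.mem_image.1 hB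
    exact hne (congrArg T (hT i j hAB))
  have h := hanti.sperner
  have hcard : Fintype.card {y // y ≠ x} = Fintype.card α - 1 := by
    simp [Fintype.card_subtype_compl]
  rwa [Finset.card_image_of_injective _ hinj, Finset.card_univ, hcard] at h

/-- If `⊤` is a join of sup-irreducible elements, the co-complement of `a` is the join of those
not below `a`. -/
theorem hnot_eq_sup_filter_not_le {ι L : Type*} [Fintype ι] [CoheytingAlgebra L] (b : ι → L)
    (hirr : ∀ i, SupIrred (b i)) (htop : Finset.univ.sup b = ⊤) (a : L)
    [DecidablePred fun i => ¬ b i ≤ a] :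
    ￢a = (Finset.univ.filter fun i => ¬ b i ≤ a).sup b := by
  apply le_antisymm
  · rw [hnot_le_iff_codisjoint_left, codisjoint_iff_le_sup, ← htop]
    refine Finset.sup_le fun i _ => ?_
    by_cases h : b i ≤ a
    · exact h.trans le_sup_right
    · exact (Finset.le_sup (f := b) (Finset.mem_filter.2 ⟨Finset.mem_univ i, h⟩)).trans le_sup_left
  · refine Finset.sup_le fun i hi => ?_
    have h : b i ≤ a ⊔ ￢a := by simp
    exact ((hirr i).supPrime.le_sup.1 h).resolve_left (Finset.mem_filter.1 hi).2


/-- Theorem 3.10(i): if `k = C(n, ⌊n/2⌋)` (with `n, k ≥ 2`) and `L` is a co-Heyting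
algebra whose top is the join of an antichain of `m ≤ n` join-irreducible elements,
then `L` satisfies the generalized weak law of the excluded middle `φ_k`. -/
theorem brouwer_satisfies_phi_k {n k m : ℕ} (hn : 2 ≤ n) (hk : 2 ≤ k)
    (hkn : k = n.choose (n / 2)) {L : Type*} [CoheytingAlgebra L]
    (hm : m ≤ n) (b : Fin m → L)
    (hirr : ∀ i, SupIrred (b i))
    (hanti : ∀ i j, i ≠ j → ¬ b i ≤ b j)
    (htop : Finset.univ.sup b = ⊤) :
    ∀ a : Fin k → L,
      ((Finset.univ.filter fun p : Fin k × Fin k => p.1 ≠ p.2).inf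
          fun p => ￢(a p.2) \ ￢(a p.1)) ⊓
        ￢(Finset.univ.sup fun i => ￢(a i)) = ⊥ := by
  classical
  intro a
  set S : Fin k → Finset (Fin m) := fun i => Finset.univ.filter fun j => ¬ b j ≤ a i
  have hS : ∀ i, ￢(a i) = (S i).sup b := fun i => hnot_eq_sup_filter_not_le b hirr htop (a i)
  by_cases hcmp : ∃ i j, i ≠ j ∧ S j ⊆ S i
  · obtain ⟨i, j, hne, hsub⟩ := hcmp
    have hbot : ￢(a j) \ ￢(a i) = ⊥ := by
      rw [sdiff_eq_bot_iff, hS, hS]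
      exact Finset.sup_mono hsub
    refine le_bot_iff.1 (inf_le_left.trans ?_)
    rw [← hbot]
    exact Finset.inf_le (f := fun p : Fin k × Fin k => ￢(a p.2) \ ￢(a p.1)) (b := (i, j))
      (by simpa using hne)
  · push Not at hcmp
    have hcover : ∀ x, ∃ i, x ∈ S i := by
      intro x
      by_contra! hx
      have hle := Finset.card_le_choose_half_of_notMem S (fun i j h => hcmp j i h.symm) x hx
      simp only [Fintype.card_fin] at hle
      have hmono := Nat.choose_half_monotone (Nat.sub_le_sub_right hm 1)
      have hlt := Nat.choose_half_lt_choose_half_succ (n := n - 1) (by omega)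
      rw [Nat.sub_add_cancel (by omega)] at hlt
      dsimp only at hmono
      omega
    have hsup : Finset.univ.sup (fun i => ￢(a i)) = ⊤ := by
      rw [eq_top_iff, ← htop]
      refine Finset.sup_le fun x _ => ?_
      obtain ⟨i, hi⟩ := hcover x
      refine le_trans ?_ (Finset.le_sup (f := fun i => ￢(a i)) (Finset.mem_univ i))
      simp only [hS]
      exact Finset.le_sup (f := b) hi
    rw [hsup, hnot_top, inf_bot_eq]
end

section
/- Let n, k ≥ 2 be natural numbers with k = C(n, ⌊n/2⌋) (the binomial coefficient). Let L be a co-Heyting algebra in which ⊥ is meet-irreducible (for all x, y ∈ L, x ⊓ y = ⊥ implies x = ⊥ or y = ⊥), and suppose ⊤ is the join of an antichain of m join-irreducible elements with m > n, i.e., there are pairwise incomparable join-irreducible elements b_1, …, b_m ∈ L with b_1 ⊔ … ⊔ b_m = ⊤. Then L does not satisfy φ_k: there exist a_1, …, a_k ∈ L such that (⨅_{i ≠ j, 1 ≤ i,j ≤ k} (￢a_j \ ￢a_i)) ⊓ ￢(⨆_{1 ≤ i ≤ k} ￢a_i) ≠ ⊥. (This is Theorem 3.10(ii).) -/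
/-- If `⊥` is meet-irreducible and `⊥ ≠ ⊤`, a finite meet of nonzero elements is nonzero. -/
theorem Finset.inf_ne_bot_of_forall_ne_bot {ι L : Type*} [Lattice L] [BoundedOrder L]
    (hbot : ∀ x y : L, x ⊓ y = ⊥ → x = ⊥ ∨ y = ⊥) (htop : (⊤ : L) ≠ ⊥)
    (s : Finset ι) (f : ι → L) (hf : ∀ i ∈ s, f i ≠ ⊥) : s.inf f ≠ ⊥ := by
  classical
  induction s using Finset.induction_on with
  | empty => simpa using htop
  | insert i s _ ih =>
    rw [Finset.inf_insert]
    intro h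
    rcases hbot _ _ h with h | h
    · exact hf i (Finset.mem_insert_self i s) h
    · exact ih (fun j hj => hf j (Finset.mem_insert_of_mem hj)) h

/-- A member of an antichain of join-irreducible elements lies below a finite join of members
only if it is one of them. -/
theorem SupIrred.le_sup_iff_mem {ι L : Type*} [DistribLattice L] [OrderBot L] {b : ι → L}
    (hirr : ∀ i, SupIrred (b i)) (hanti : ∀ i j, i ≠ j → ¬ b i ≤ b j) {i : ι} {s : Finset ι} :
    b i ≤ s.sup b ↔ i ∈ s := by
  refine ⟨fun h => ?_, Finset.le_sup⟩
  obtain ⟨j, hj, hij⟩ := (supPrime_iff_supIrred.2 (hirr i)).le_finset_sup.1 h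
  by_contra hi
  exact hanti i j (fun e => hi (e ▸ hj)) hij

/-- If the top element is the join of a finite antichain of join-irreducible elements, the
co-complement of a join over a complement is the join over the original set. -/
theorem hnot_sup_compl_of_supIrred {ι L : Type*} [Fintype ι] [DecidableEq ι]
    [CoheytingAlgebra L] {b : ι → L} (hirr : ∀ i, SupIrred (b i))
    (hanti : ∀ i j, i ≠ j → ¬ b i ≤ b j) (htop : Finset.univ.sup b = ⊤) (s : Finset ι) :
    ￢(sᶜ.sup b) = s.sup b := by
  apply le_antisymm
  · rw [← top_sdiff', sdiff_le_iff, ← Finset.sup_union, Finset.union_comm,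
      Finset.union_compl, htop]
  · refine Finset.sup_le fun i hi => ?_
    have h : b i ≤ sᶜ.sup b ⊔ ￢(sᶜ.sup b) := by
      rw [sup_hnot_self]
      exact le_top
    refine ((supPrime_iff_supIrred.2 (hirr i)).le_sup.1 h).resolve_left fun h => ?_
    exact Finset.mem_compl.1 ((SupIrred.le_sup_iff_mem hirr hanti).1 h) hi


/-- Theorem 3.10(ii): if `k = C(n, ⌊n/2⌋)` (with `n, k ≥ 2`) and `L` is a co-Heyting
algebra with meet-irreducible `⊥` whose top is the join of an antichain of `m > n`
join-irreducible elements, then `L` does not satisfy `φ_k`. -/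
theorem brouwer_not_satisfies_phi_k {n k m : ℕ} (hn : 2 ≤ n) (hk : 2 ≤ k)
    (hkn : k = n.choose (n / 2)) {L : Type*} [CoheytingAlgebra L]
    (hbot : ∀ x y : L, x ⊓ y = ⊥ → x = ⊥ ∨ y = ⊥)
    (hm : n < m) (b : Fin m → L)
    (hirr : ∀ i, SupIrred (b i))
    (hanti : ∀ i j, i ≠ j → ¬ b i ≤ b j)
    (htop : Finset.univ.sup b = ⊤) :
    ∃ a : Fin k → L,
      ((Finset.univ.filter fun p : Fin k × Fin k => p.1 ≠ p.2).inf
          fun p => ￢(a p.2) \ ￢(a p.1)) ⊓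
        ￢(Finset.univ.sup fun i => ￢(a i)) ≠ ⊥ := by
  classical
  set T : Finset (Fin m) := Finset.univ.map (Fin.castLEEmb hm.le) with hT
  have hcard : (Finset.powersetCard (n / 2) T).card = k := by
    simp [hT, hkn]
  let e := (Finset.equivFinOfCardEq hcard).symm
  let S : Fin k → Finset (Fin m) := fun i => (e i).1
  have hS : ∀ i, S i ⊆ T ∧ (S i).card = n / 2 := fun i =>
    Finset.mem_powersetCard.1 (e i).2
  have hlast : (⟨n, hm⟩ : Fin m) ∉ T := by
    simp only [hT, Finset.mem_map, Finset.mem_univ, true_and, not_exists]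
    intro x hx
    exact x.2.ne (congrArg Fin.val hx)
  have hne : (⊤ : L) ≠ ⊥ := fun h =>
    (hirr ⟨n, hm⟩).ne_bot (le_bot_iff.1 (h ▸ le_top))
  refine ⟨fun i => (S i)ᶜ.sup b, fun h => ?_⟩
  simp only [hnot_sup_compl_of_supIrred hirr hanti htop] at h
  rcases hbot _ _ h with h | h
  · refine Finset.inf_ne_bot_of_forall_ne_bot hbot hne _ _ (fun p hp hp' => ?_) h
    have hsub : S p.2 ⊆ S p.1 := fun i hi =>
      (SupIrred.le_sup_iff_mem hirr hanti).1 ((Finset.le_sup hi).trans (sdiff_eq_bot_iff.1 hp'))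
    have heq := Finset.eq_of_subset_of_card_le hsub ((hS p.1).2.trans (hS p.2).2.symm).le
    exact (Finset.mem_filter.1 hp).2 (e.injective (Subtype.ext heq.symm))
  · rw [← top_sdiff', sdiff_eq_bot_iff] at h
    have hle : (Finset.univ.sup fun i => (S i).sup b) ≤ T.sup b :=
      Finset.sup_le fun i _ => Finset.sup_mono (hS i).1
    exact hlast ((SupIrred.le_sup_iff_mem hirr hanti).1 (le_top.trans (h.trans hle)))
end

section
/- Let L be a co-Heyting algebra in which ⊥ is meet-irreducible (for all x, y ∈ L, x ⊓ y = ⊥ implies x = ⊥ or y = ⊥), and suppose ⊤ is the join of an antichain of m join-irreducible elements b_1, …, b_m (pairwise incomparable, each join-irreducible, with b_1 ⊔ … ⊔ b_m = ⊤). Then L satisfies the weak law of the excluded middle, i.e., ￢a ⊓ ￢￢a = ⊥ for every a ∈ L, if and only if m ≤ 1. (This is the case k = 1 of Theorem 3.10, for the formula φ_1 = ¬p ∨ ¬¬p.) -/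
theorem hnot_eq_bot_iff_eq_top {L : Type*} [CoheytingAlgebra L] {a : L} :
    ￢a = ⊥ ↔ a = ⊤ := by
  rw [← top_sdiff', sdiff_eq_bot_iff, top_le_iff]

/-- If `⊤` is join-irreducible, then every element is either `⊤` or has co-complement `⊤`,
so the weak law of the excluded middle holds. -/
theorem SupIrred.hnot_inf_hnot_hnot {L : Type*} [CoheytingAlgebra L]
    (h : SupIrred (⊤ : L)) (a : L) : ￢a ⊓ ￢￢a = ⊥ := by
  rcases h.2 (codisjoint_hnot_right (a := a)).eq_top with ha | ha
  · simp [ha]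
  · simp [ha]

/-- A join-irreducible member of an antichain with join `⊤` has co-complement different
from `⊤`. -/
theorem SupIrred.hnot_ne_top_of_sup_eq_top {L ι : Type*} [CoheytingAlgebra L] [Fintype ι]
    {b : ι → L} {i : ι} (hi : SupIrred (b i)) (hanti : ∀ j, i ≠ j → ¬ b i ≤ b j)
    (htop : Finset.univ.sup b = ⊤) : ￢(b i) ≠ ⊤ := by
  classical
  intro h
  have hc : b i ⊔ (Finset.univ.erase i).sup b = ⊤ := by
    rw [← Finset.sup_insert, Finset.insert_erase (Finset.mem_univ i), htop]
  have hle : ￢(b i) ≤ (Finset.univ.erase i).sup b :=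
    (codisjoint_iff.mpr hc).hnot_le_right
  obtain ⟨j, hj, hij⟩ := (supPrime_iff_supIrred.mpr hi).le_finset_sup.mp
    (le_top.trans (h ▸ hle))
  exact hanti j (Finset.ne_of_mem_erase hj).symm hij

/-- The case `k = 1` of Theorem 3.10: a co-Heyting algebra with meet-irreducible `⊥`
whose top is the join of an antichain of `m` join-irreducible elements satisfies the
weak law of the excluded middle `¬p ∨ ¬¬p` if and only if `m ≤ 1`. -/
theorem wlem_iff_le_one {L : Type*} [CoheytingAlgebra L]
    (hbot : ∀ x y : L, x ⊓ y = ⊥ → x = ⊥ ∨ y = ⊥)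
    (m : ℕ) (b : Fin m → L)
    (hirr : ∀ i, SupIrred (b i))
    (hanti : ∀ i j, i ≠ j → ¬ b i ≤ b j)
    (htop : Finset.univ.sup b = ⊤) :
    (∀ a : L, ￢a ⊓ ￢￢a = ⊥) ↔ m ≤ 1 := by
  constructor
  · intro h
    by_contra! hm
    let i : Fin m := ⟨0, by omega⟩
    let j : Fin m := ⟨1, by omega⟩
    have hji : j ≠ i := by simp [i, j]
    rcases hbot _ _ (h (b i)) with h0 | h0
    · exact hanti j i hji (le_top.trans (hnot_eq_bot_iff_eq_top.mp h0).ge)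
    · exact (hirr i).hnot_ne_top_of_sup_eq_top (hanti i) htop (hnot_eq_bot_iff_eq_top.mp h0)
  · intro hm a
    interval_cases m
    · have : Subsingleton L := subsingleton_of_bot_eq_top (by simpa using htop)
      exact Subsingleton.elim _ _
    · have hb : b 0 = ⊤ := by simpa using htop
      exact (hb ▸ hirr 0).hnot_inf_hnot_hnot a
end

section
/- Let L be a finite co-Heyting algebra and n a natural number. Then L has exactly n coatoms if and only if the top element ⊤ of L is the join of an antichain of n join-irreducible elements, i.e., there is a set S of n pairwise incomparable join-irreducible elements of L whose supremum is ⊤. (This is Lemma 3.7: a finite Brouwer algebra has exactly n coatoms iff it belongs to the class 𝔅_n.) -/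
open scoped Classical in
/-- The join of all elements not above `a`; when `a` is sup-prime, the greatest such element. -/
noncomputable def supNotAbove {L : Type*} [Lattice L] [OrderBot L] [Fintype L] (a : L) : L :=
  (Finset.univ.filter fun x => ¬ a ≤ x).sup id

theorem le_supNotAbove_iff {L : Type*} [Lattice L] [OrderBot L] [Fintype L] {a : L}
    (ha : SupPrime a) {x : L} : x ≤ supNotAbove a ↔ ¬ a ≤ x := by
  classical
  refine ⟨fun h hax => ?_, fun h => Finset.le_sup (f := id) (by simpa using h)⟩
  obtain ⟨y, hy, hay⟩ := ha.le_finset_sup.1 (hax.trans h)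
  exact (Finset.mem_filter.1 hy).2 hay

section Antichain

variable {L : Type*} [DistribLattice L] [BoundedOrder L] [Fintype L] {S : Finset L}

theorem isCoatom_supNotAbove (hS : ∀ a ∈ S, SupPrime a) (hanti : IsAntichain (· ≤ ·) (S : Set L))
    (htop : S.sup id = ⊤) {a : L} (ha : a ∈ S) : IsCoatom (supNotAbove a) := by
  have hprime := hS a ha
  refine ⟨fun h => (le_supNotAbove_iff hprime).1 h.ge le_top, fun x hx => ?_⟩
  have hax : a ≤ x := not_not.1 fun h => hx.not_ge ((le_supNotAbove_iff hprime).2 h)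
  refine top_unique (htop ▸ Finset.sup_le fun b hb => ?_)
  obtain rfl | hab := eq_or_ne a b
  · exact hax
  · exact ((le_supNotAbove_iff hprime).2 (hanti ha hb hab)).trans hx.le

theorem ncard_coatoms_eq_card (hS : ∀ a ∈ S, SupPrime a)
    (hanti : IsAntichain (· ≤ ·) (S : Set L)) (htop : S.sup id = ⊤) :
    {c : L | IsCoatom c}.ncard = S.card := by
  rw [← Set.ncard_coe_finset]
  refine (Set.ncard_congr (fun a _ => supNotAbove a)
    (fun a ha => isCoatom_supNotAbove hS hanti htop ha) (fun a b ha hb hab => ?_)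
    fun c hc => ?_).symm
  · have h (x : L) : a ≤ x ↔ b ≤ x := by
      rw [← not_iff_not, ← le_supNotAbove_iff (hS a ha), ← le_supNotAbove_iff (hS b hb), hab]
    exact eq_of_forall_ge_iff h
  · obtain ⟨a, ha, hac⟩ : ∃ a ∈ S, ¬ a ≤ c := by
      by_contra! h
      exact hc.1 (top_unique (htop ▸ Finset.sup_le h))
    refine ⟨a, ha, ?_⟩
    exact (hc.le_iff_eq (isCoatom_supNotAbove hS hanti htop ha).1).1
      ((le_supNotAbove_iff (hS a ha)).2 hac)

end Antichain

/-- In a well-founded lattice every element is the join of a finite antichain of join-irreducible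
elements. -/
theorem exists_supIrred_antichain_sup_eq {L : Type*} [SemilatticeSup L] [OrderBot L]
    [WellFoundedLT L] (a : L) :
    ∃ S : Finset L, (∀ b ∈ S, SupIrred b) ∧ IsAntichain (· ≤ ·) (S : Set L) ∧ S.sup id = a := by
  classical
  obtain ⟨s, hs, hirr⟩ := exists_supIrred_decomposition a
  refine ⟨s.filter fun b => Maximal (· ∈ s) b,
    fun b hb => hirr (Finset.mem_filter.1 hb).1, ?_, ?_⟩
  · intro b hb c hc hbc hle
    exact hbc ((Finset.mem_filter.1 hb).2.eq_of_le (Finset.mem_filter.1 hc).1 hle)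
  · refine le_antisymm ((Finset.sup_mono (Finset.filter_subset _ _)).trans_eq hs) ?_
    rw [← hs]
    refine Finset.sup_le fun b hb => ?_
    obtain ⟨c, hbc, hc⟩ := s.exists_le_maximal hb
    exact hbc.trans (Finset.le_sup (f := id) (Finset.mem_filter.2 ⟨hc.1, hc⟩))

/-- Lemma 3.7: a finite Brouwer (co-Heyting) algebra has exactly `n` coatoms if and
only if its top element is the join of an antichain of `n` join-irreducible elements. -/
theorem coatoms_card_iff_antichain {L : Type*} [CoheytingAlgebra L] [Fintype L] (n : ℕ) :
    {c : L | IsCoatom c}.ncard = n ↔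
      ∃ S : Finset L, S.card = n ∧ (∀ a ∈ S, SupIrred a) ∧
        IsAntichain (· ≤ ·) (S : Set L) ∧ S.sup id = ⊤ := by
  constructor
  · rintro rfl
    obtain ⟨S, hirr, hanti, htop⟩ := exists_supIrred_antichain_sup_eq (⊤ : L)
    exact ⟨S, (ncard_coatoms_eq_card (fun a ha => (hirr a ha).supPrime) hanti htop).symm,
      hirr, hanti, htop⟩
  · rintro ⟨S, rfl, hirr, hanti, htop⟩
    exact ncard_coatoms_eq_card (fun a ha => (hirr a ha).supPrime) hanti htop
end

section
/- Let L be a co-Heyting algebra and let b_1, …, b_n be an antichain of join-irreducible elements of L with b_1 ⊔ … ⊔ b_n = ⊤. Then for every a ∈ L, ￢a = ⨆_{i ∈ I} b_i, where I = { i ∈ {1,…,n} : b_i ≰ a } (with the empty join equal to ⊥). In particular every value of ￢ in L is a join of a subset of {b_1,…,b_n}. (This is Lemma 3.9.) -/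
open Classical in
/-- Lemma 3.9: if `⊤` is the join of an antichain `b_1, …, b_n` of join-irreducible
elements of a co-Heyting algebra `L`, then for every `a ∈ L` the co-complement `￢a`
is the join of those `b_i` with `b_i ≰ a`. -/
theorem hnot_eq_sup_of_antichain {L : Type*} [CoheytingAlgebra L] {n : ℕ}
    (b : Fin n → L)
    (hirr : ∀ i, SupIrred (b i))
    (hanti : ∀ i j, i ≠ j → ¬ b i ≤ b j)
    (htop : Finset.univ.sup b = ⊤) :
    ∀ a : L, ￢a = (Finset.univ.filter fun i => ¬ b i ≤ a).sup b := by
  intro a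
  apply le_antisymm
  · rw [← top_sdiff', sdiff_le_iff, ← htop]
    refine Finset.sup_le fun i _ => ?_
    by_cases h : b i ≤ a
    · exact le_sup_of_le_left h
    · exact le_sup_of_le_right (Finset.le_sup (by simpa using h))
  · refine Finset.sup_le fun i hi => ?_
    have h : b i ≤ a ⊔ ￢a := by simp
    exact ((hirr i).supPrime.2 h).resolve_left (Finset.mem_filter.1 hi).2
end

section
/- Let L be a co-Heyting algebra and let b_1, …, b_n be an antichain of join-irreducible elements of L with b_1 ⊔ … ⊔ b_n = ⊤. Then for every i, ￢(b_i) = ⨆_{j ≠ i} b_j (with the empty join equal to ⊥ when n = 1). (This is the 'in particular' clause of Lemma 3.9.) -/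
open Classical in
/-- The "in particular" clause of Lemma 3.9: if `⊤` is the join of an antichain
`b_1, …, b_n` of join-irreducible elements of a co-Heyting algebra `L`, then
`￢(b_i) = ⨆_{j ≠ i} b_j` for every `i`. -/
theorem hnot_supIrred_eq_sup_others {L : Type*} [CoheytingAlgebra L] {n : ℕ}
    (b : Fin n → L)
    (hirr : ∀ i, SupIrred (b i))
    (hanti : ∀ i j, i ≠ j → ¬ b i ≤ b j)
    (htop : Finset.univ.sup b = ⊤) :
    ∀ i, ￢(b i) = (Finset.univ.filter fun j => j ≠ i).sup b := by
  intro i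
  apply le_antisymm
  · rw [hnot_le_iff_codisjoint_right, codisjoint_iff_le_sup, ← htop]
    refine Finset.sup_le fun j _ => ?_
    by_cases hj : j = i
    · exact hj ▸ le_sup_left
    · exact le_sup_of_le_right (Finset.le_sup (by simp [hj]))
  · refine Finset.sup_le fun j hj => ?_
    have hji : j ≠ i := (Finset.mem_filter.mp hj).2
    have h : b j ≤ b i ⊔ ￢(b i) := by simp
    exact ((hirr j).supPrime.le_sup.mp h).resolve_left (hanti j i hji)
end

section
/- Let K be a partially ordered set whose set of maximal elements is finite of cardinality n + 1, and such that every element of K lies below some maximal element. Let V_1, …, V_k be upward-closed subsets of K (valuations of the variables p_1, …, p_k) such that the formula φ_k is falsified, i.e.: (a) for every ordered pair i ≠ j there exists y ∈ K such that no z ≥ y belongs to V_i but some z ≥ y belongs to V_j (the disjunct ¬p_i → ¬p_j is falsified), and (b) there exists y ∈ K such that for every i and every z ≥ y, z ∉ V_i (the disjunct ¬(¬p_1 ∧ … ∧ ¬p_k) is falsified). Then k ≤ C(n, ⌊n/2⌋). (This is Lemma 2.3, stated in terms of Kripke forcing: a Kripke frame of topwidth n+1 falsifying φ_k satisfies C(n,⌊n/2⌋)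 ≥ k.) -/
/-- Lemma 2.3: if a Kripke frame `K` (a poset) has exactly `n + 1` maximal elements,
every element lies below some maximal element, and a valuation of the variables
`p_1, …, p_k` by upward-closed sets falsifies `φ_k`, then `k ≤ C(n, ⌊n/2⌋)`. -/
theorem kripke_topwidth_falsify_phi_k {K : Type*} [PartialOrder K] {n k : ℕ}
    (hfin : {x : K | IsMax x}.Finite)
    (hcard : {x : K | IsMax x}.ncard = n + 1)
    (hbelow : ∀ y : K, ∃ x : K, IsMax x ∧ y ≤ x)
    (V : Fin k → Set K)
    (hV : ∀ i, IsUpperSet (V i))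
    (ha : ∀ i j : Fin k, i ≠ j →
      ∃ y : K, (∀ z, y ≤ z → z ∉ V i) ∧ (∃ z, y ≤ z ∧ z ∈ V j))
    (hb : ∃ y : K, ∀ i : Fin k, ∀ z, y ≤ z → z ∉ V i) :
    k ≤ n.choose (n / 2) := by
  classical
  obtain ⟨y₀, hy₀⟩ := hb
  obtain ⟨x₀, hx₀, hyx₀⟩ := hbelow y₀
  let M : Finset K := hfin.toFinset.erase x₀
  have hM : M.card = n := by
    rw [Finset.card_erase_of_mem (by simpa using hx₀), ← Set.ncard_eq_toFinset_card _ hfin, hcard,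
      Nat.add_sub_cancel]
  let A : Fin k → Finset M := fun i => {x | (x : K) ∈ V i}
  have hA : ∀ i j, i ≠ j → ¬ A j ⊆ A i := by
    intro i j hij hsub
    obtain ⟨y, hyi, z, hyz, hz⟩ := ha i j hij
    obtain ⟨x, hx, hzx⟩ := hbelow z
    have hxj : x ∈ V j := hV j hzx hz
    have hxM : x ∈ M := by
      refine Finset.mem_erase.2 ⟨?_, by simpa using hx⟩
      rintro rfl
      exact hy₀ j x hyx₀ hxj
    have hmem : (⟨x, hxM⟩ : M) ∈ A i := hsub (by simpa [A] using hxj)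
    exact hyi x (hyz.trans hzx) (by simpa [A] using hmem)
  have hinj : Function.Injective A := fun i j hij => by
    by_contra hne
    exact hA i j hne hij.ge
  have hanti : IsAntichain (· ⊆ ·) ((Finset.univ.image A : Finset (Finset M)) : Set (Finset M)) := by
    intro s hs t ht hst
    obtain ⟨i, -, rfl⟩ := Finset.mem_image.1 (Finset.mem_coe.1 hs)
    obtain ⟨j, -, rfl⟩ := Finset.mem_image.1 (Finset.mem_coe.1 ht)
    exact hA j i fun h => hst (congrArg A h.symm)
  simpa [Finset.card_image_of_injective _ hinj, hM] using hanti.sperner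
end

section
/- Let n ≥ 2 and let 𝒜 be an antichain of subsets of an n-element set (say subsets of Fin n, pairwise incomparable under inclusion) with |𝒜| = C(n, ⌊n/2⌋). Then the union of the sets in 𝒜 is the whole n-element set. (This covering property of maximum-size antichains is the key combinatorial step, via Sperner's Theorem, in the proof of Theorem 3.10(i).) -/
/-- **Sperner's theorem** for an antichain of subsets of a finite set `s`. -/
theorem IsAntichain.card_le_choose_of_forall_subset {α : Type*} [DecidableEq α]
    {𝒜 : Finset (Finset α)} {s : Finset α}
    (hanti : IsAntichain (· ⊆ ·) (𝒜 : Set (Finset α))) (hs : ∀ A ∈ 𝒜, A ⊆ s) :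
    𝒜.card ≤ s.card.choose (s.card / 2) := by
  have hsub : ∀ A ∈ 𝒜, ∀ B : Finset α,
      A.subtype (· ∈ s) ⊆ B.subtype (· ∈ s) → A ⊆ B := by
    intro A hA B h a ha
    have := @h ⟨a, hs A hA ha⟩ (Finset.mem_subtype.2 ha)
    exact Finset.mem_subtype.1 this
  have hinj : Set.InjOn (fun A : Finset α => A.subtype (· ∈ s)) (𝒜 : Set (Finset α)) :=
    fun A hA B hB h => (hsub A hA B h.subset).antisymm (hsub B hB A h.symm.subset)
  have himage : IsAntichain (· ⊆ ·)
      ((𝒜.image fun A => A.subtype (· ∈ s) : Finset (Finset s)) : Set (Finset s)) := by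
    rw [Finset.coe_image]
    rintro _ ⟨A, hA, rfl⟩ _ ⟨B, hB, rfl⟩ hne hle
    exact hne (congrArg _ (hanti.eq hA hB (hsub A hA B hle)))
  simpa [Finset.card_image_of_injOn hinj] using himage.sperner

theorem Nat.choose_half_lt_choose_succ_half {m : ℕ} (hm : 1 ≤ m) :
    m.choose (m / 2) < (m + 1).choose ((m + 1) / 2) := by
  have hpos : 0 < m.choose (m / 2 + 1) := Nat.choose_pos (by omega)
  calc m.choose (m / 2) < (m + 1).choose (m / 2 + 1) := by
        rw [Nat.choose_succ_succ']
        omega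
    _ ≤ _ := Nat.choose_le_middle _ _

/-- The key combinatorial step in the proof of Theorem 3.10(i): for `n ≥ 2`, any
antichain of subsets of `Fin n` of maximum size `C(n, ⌊n/2⌋)` (Sperner's Theorem)
covers all of `Fin n`. -/
theorem max_antichain_covers {n : ℕ} (hn : 2 ≤ n)
    (𝒜 : Finset (Finset (Fin n)))
    (hanti : IsAntichain (· ⊆ ·) (𝒜 : Set (Finset (Fin n))))
    (hcard : 𝒜.card = n.choose (n / 2)) :
    𝒜.sup id = (Finset.univ : Finset (Fin n)) := by
  by_contra hne
  obtain ⟨x, hx⟩ : ∃ x, x ∉ 𝒜.sup id := by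
    simpa [Finset.eq_univ_iff_forall] using hne
  have hs : ∀ A ∈ 𝒜, A ⊆ Finset.univ.erase x := fun A hA a ha =>
    Finset.mem_erase.2 ⟨fun h => hx (Finset.mem_sup.2 ⟨A, hA, h ▸ ha⟩), Finset.mem_univ a⟩
  have hle := hanti.card_le_choose_of_forall_subset hs
  obtain ⟨m, rfl⟩ : ∃ m, n = m + 1 := ⟨n - 1, by omega⟩
  have hlt := Nat.choose_half_lt_choose_succ_half (m := m) (by omega)
  rw [hcard, Finset.card_erase_of_mem (Finset.mem_univ x), Finset.card_univ, Fintype.card_fin,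
    Nat.add_sub_cancel] at hle
  exact hlt.not_ge hle
end
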